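/- arXiv:2411.18955 — 2 statements merged into one kernel-verified Lean document; each statement's English description precedes it below -/
import Mathlib

section
/- For every simple digraph G = (V,E), the R-module Ω_n(G) decomposes as a direct sum Ω_n(G) = ⊕_{a,b ∈ V} Ω_n^{[a,b]}(G), where Ω_n^{[a,b]}(G) is the submodule of Ω_n(G) generated by (a,b)-cluster paths. -/
noncomputable section

namespace PrimitivePath

/-- A simple digraph: arrows between distinct vertices. -/
structure SDigraph (V : Type) where
  Adj : V → V → Prop
  loopless : ∀ v, ¬ Adj v v

section

variable (R V : Type) [CommRing R] [DecidableEq V]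

/-- `Chain R V n` is the free `R`-module `Λ_n(V,R)` on elementary `n`-paths
(sequences of `n+1` vertices). -/
abbrev Chain (n : ℕ) : Type _ := (Fin (n + 1) → V) →₀ R

/-- An elementary path is allowed if consecutive vertices are joined by arrows. -/
def IsAllowed {V : Type} (G : SDigraph V) {n : ℕ} (p : Fin (n + 1) → V) : Prop :=
  ∀ i : Fin n, G.Adj (p i.castSucc) (p i.succ)

/-- An elementary path is regular if it has no two equal consecutive vertices. -/
def IsRegular {V : Type} {n : ℕ} (p : Fin (n + 1) → V) : Prop :=
  ∀ i : Fin n, p i.castSucc ≠ p i.succ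

instance {n : ℕ} (p : Fin (n + 1) → V) : Decidable (IsRegular p) :=
  inferInstanceAs (Decidable (∀ i : Fin n, p i.castSucc ≠ p i.succ))

/-- The differential `∂ : Λ_{n+1} → Λ_n`, alternating sum of vertex deletions. -/
def boundary (n : ℕ) : Chain R V (n + 1) →ₗ[R] Chain R V n :=
  Finsupp.lsum R fun p => ∑ m : Fin (n + 2),
    ((-1 : R) ^ (m : ℕ)) • Finsupp.lsingle (fun i : Fin (n + 1) => p (m.succAbove i))

/-- The `m`-th face map `∂^m : Λ_{n+1} → Λ_n`, deleting the `m`-th vertex. -/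
def faceMap (n : ℕ) (m : Fin (n + 2)) : Chain R V (n + 1) →ₗ[R] Chain R V n :=
  Finsupp.lsum R fun p => Finsupp.lsingle (fun i : Fin (n + 1) => p (m.succAbove i))

/-- The submodule of chains all of whose elementary paths satisfy `P`. -/
def pathsWith {n : ℕ} (P : (Fin (n + 1) → V) → Prop) : Submodule R (Chain R V n) where
  carrier := {w | ∀ p ∈ w.support, P p}
  add_mem' := by
    intro x y hx hy p hp
    rcases Finset.mem_union.1 (Finsupp.support_add hp) with h | h
    · exact hx p h
    · exact hy p h
  zero_mem' := by intro p hp; simp at hp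
  smul_mem' := by intro c x hx p hp; exact hx p (Finsupp.support_smul hp)

/-- `A_n(G)`: the submodule of allowed chains. -/
def allowedChains (G : SDigraph V) (n : ℕ) : Submodule R (Chain R V n) :=
  pathsWith R V (fun p => IsAllowed G p)

/-- Chains all of whose elementary paths have tail vertex `a`. -/
def tailSet (a : V) (n : ℕ) : Submodule R (Chain R V n) :=
  pathsWith R V (fun p => p 0 = a)

/-- Chains all of whose elementary paths have head vertex `b`. -/
def headSet (b : V) (n : ℕ) : Submodule R (Chain R V n) :=
  pathsWith R V (fun p => p (Fin.last n) = b)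

/-- Chains all of whose elementary paths have tail `a` and head `b`
(the `(a,b)`-cluster module `Λ_n^{[a,b]}`). -/
def clusterSet (a b : V) (n : ℕ) : Submodule R (Chain R V n) :=
  pathsWith R V (fun p => p 0 = a ∧ p (Fin.last n) = b)

/-- Projection killing the irregular elementary paths, modelling `Λ_n → R_n = Λ_n/I_n`. -/
def regProj (n : ℕ) : Chain R V n →ₗ[R] Chain R V n :=
  Finsupp.lsum R fun p => if IsRegular p then Finsupp.lsingle p else 0

/-- The `(a,b)`-cluster component `w ↦ w^{[a,b]}`. -/
def clusterComp (a b : V) (n : ℕ) : Chain R V n →ₗ[R] Chain R V n :=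
  Finsupp.lsum R fun p =>
    if p 0 = a ∧ p (Fin.last n) = b then Finsupp.lsingle p else 0

/-- The `a`-tail component `w ↦ w^{[a,·]}`. -/
def tailComp (a : V) (n : ℕ) : Chain R V n →ₗ[R] Chain R V n :=
  Finsupp.lsum R fun p => if p 0 = a then Finsupp.lsingle p else 0

/-- The `b`-head component `w ↦ w^{[·,b]}`. -/
def headComp (b : V) (n : ℕ) : Chain R V n →ₗ[R] Chain R V n :=
  Finsupp.lsum R fun p => if p (Fin.last n) = b then Finsupp.lsingle p else 0

/-- `Π_n(G)`: the primitive path chain modules. -/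
def piChains (G : SDigraph V) : (n : ℕ) → Submodule R (Chain R V n)
  | 0 => allowedChains R V G 0
  | n + 1 =>
      allowedChains R V G (n + 1) ⊓ (allowedChains R V G n).comap (boundary R V n)

/-- `Ω_n(G)`: the path chain modules (differential taken modulo irregular paths). -/
def omegaChains (G : SDigraph V) : (n : ℕ) → Submodule R (Chain R V n)
  | 0 => allowedChains R V G 0
  | n + 1 =>
      allowedChains R V G (n + 1) ⊓
        (allowedChains R V G n).comap ((regProj R V n).comp (boundary R V n))

/-- Cycles of the primitive path chain complex. -/
def piCycles (G : SDigraph V) : (n : ℕ) → Submodule R (Chain R V n)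
  | 0 => piChains R V G 0
  | n + 1 => piChains R V G (n + 1) ⊓ LinearMap.ker (boundary R V n)

/-- Boundaries of the primitive path chain complex. -/
def piBoundaries (G : SDigraph V) (n : ℕ) : Submodule R (Chain R V n) :=
  (piChains R V G (n + 1)).map (boundary R V n)

/-- Primitive path homology `H_n(Π_*(G))`: the image of the cycles in the
quotient by the boundaries. -/
abbrev piHomology (G : SDigraph V) (n : ℕ) : Type _ :=
  ↥((piCycles R V G n).map (piBoundaries R V G n).mkQ)

/-- Cycles of the path chain complex `Ω_*`. -/
def omegaCycles (G : SDigraph V) : (n : ℕ) → Submodule R (Chain R V n)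
  | 0 => omegaChains R V G 0
  | n + 1 => omegaChains R V G (n + 1) ⊓ LinearMap.ker ((regProj R V n).comp (boundary R V n))

/-- Boundaries of the path chain complex `Ω_*`. -/
def omegaBoundaries (G : SDigraph V) (n : ℕ) : Submodule R (Chain R V n) :=
  (omegaChains R V G (n + 1)).map ((regProj R V n).comp (boundary R V n))

/-- Path homology `H_n(Ω_*(G))`. -/
abbrev omegaHomology (G : SDigraph V) (n : ℕ) : Type _ :=
  ↥((omegaCycles R V G n).map (omegaBoundaries R V G n).mkQ)

/-- The cluster differential `d : Λ_{n+2}^{[a,b]} → Λ_{n+1}^{[a,b]}`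
(alternating deletion of interior vertices only). -/
def clusterBoundary (n : ℕ) : Chain R V (n + 2) →ₗ[R] Chain R V (n + 1) :=
  Finsupp.lsum R fun p => ∑ m : Fin (n + 1),
    ((-1 : R) ^ (m : ℕ)) •
      Finsupp.lsingle (fun i : Fin (n + 2) => p (m.succ.castSucc.succAbove i))

/-- `π^{[a,b]}` in degrees `≥ 2`: delete the two end vertices. -/
def stripEnds (n : ℕ) : Chain R V (n + 2) →ₗ[R] Chain R V n :=
  Finsupp.lsum R fun p => Finsupp.lsingle (fun i : Fin (n + 1) => p i.succ.castSucc)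

/-- The sum-of-coefficients map (augmentation when `n = 0`). -/
def totalCoeff (n : ℕ) : Chain R V n →ₗ[R] R :=
  Finsupp.lsum R fun _ => LinearMap.id

/-- `A_n^{[a,b]}(G)`: allowed `(a,b)`-cluster chains. -/
def allowedCluster (G : SDigraph V) (a b : V) (n : ℕ) : Submodule R (Chain R V n) :=
  allowedChains R V G n ⊓ clusterSet R V a b n

/-- `Θ_n^{[a,b]}(G)`. -/
def thetaChains (G : SDigraph V) (a b : V) : (n : ℕ) → Submodule R (Chain R V n)
  | 0 => ⊥
  | 1 => allowedCluster R V G a b 1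
  | n + 2 =>
      allowedCluster R V G a b (n + 2) ⊓
        (allowedCluster R V G a b (n + 1)).comap (clusterBoundary R V n)

def thetaCycles (G : SDigraph V) (a b : V) : (n : ℕ) → Submodule R (Chain R V n)
  | 0 => ⊥
  | 1 => thetaChains R V G a b 1
  | n + 2 => thetaChains R V G a b (n + 2) ⊓ LinearMap.ker (clusterBoundary R V n)

def thetaBoundaries (G : SDigraph V) (a b : V) : (n : ℕ) → Submodule R (Chain R V n)
  | 0 => ⊥
  | n + 1 => (thetaChains R V G a b (n + 2)).map (clusterBoundary R V n)

/-- Primitive `(a,b)`-cluster homology `H_n^{[a,b]}(G)`. -/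
abbrev thetaHomology (G : SDigraph V) (a b : V) (n : ℕ) : Type _ :=
  ↥((thetaCycles R V G a b n).map (thetaBoundaries R V G a b n).mkQ)

/-- The tail differential `d^t` (never deleting the tail vertex). -/
def tailBoundary (n : ℕ) : Chain R V (n + 1) →ₗ[R] Chain R V n :=
  Finsupp.lsum R fun p => ∑ m : Fin (n + 1),
    ((-1 : R) ^ (m : ℕ)) • Finsupp.lsingle (fun i : Fin (n + 1) => p (m.succ.succAbove i))

/-- The head differential `d^h` (never deleting the head vertex). -/
def headBoundary (n : ℕ) : Chain R V (n + 1) →ₗ[R] Chain R V n :=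
  Finsupp.lsum R fun p => ∑ m : Fin (n + 1),
    ((-1 : R) ^ (m : ℕ)) • Finsupp.lsingle (fun i : Fin (n + 1) => p (m.castSucc.succAbove i))

/-- `π^{[a,·]}` in degrees `≥ 1`: delete the first vertex. -/
def stripHead (n : ℕ) : Chain R V (n + 1) →ₗ[R] Chain R V n :=
  Finsupp.lsum R fun p => Finsupp.lsingle (fun i : Fin (n + 1) => p i.succ)

/-- `π^{[·,a]}` in degrees `≥ 1`: delete the last vertex. -/
def stripLast (n : ℕ) : Chain R V (n + 1) →ₗ[R] Chain R V n :=
  Finsupp.lsum R fun p => Finsupp.lsingle (fun i : Fin (n + 1) => p i.castSucc)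

/-- `A_n^{[a,·]}(G)`: allowed chains with tail `a`. -/
def allowedTail (G : SDigraph V) (a : V) (n : ℕ) : Submodule R (Chain R V n) :=
  allowedChains R V G n ⊓ tailSet R V a n

/-- `A_n^{[·,a]}(G)`: allowed chains with head `a`. -/
def allowedHead (G : SDigraph V) (a : V) (n : ℕ) : Submodule R (Chain R V n) :=
  allowedChains R V G n ⊓ headSet R V a n

/-- `Θ_n^{[a,·]}(G)`. -/
def tailTheta (G : SDigraph V) (a : V) : (n : ℕ) → Submodule R (Chain R V n)
  | 0 => allowedTail R V G a 0
  | n + 1 =>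
      allowedTail R V G a (n + 1) ⊓ (allowedTail R V G a n).comap (tailBoundary R V n)

/-- `Θ_n^{[·,a]}(G)`. -/
def headTheta (G : SDigraph V) (a : V) : (n : ℕ) → Submodule R (Chain R V n)
  | 0 => allowedHead R V G a 0
  | n + 1 =>
      allowedHead R V G a (n + 1) ⊓ (allowedHead R V G a n).comap (headBoundary R V n)

def tailCycles (G : SDigraph V) (a : V) : (n : ℕ) → Submodule R (Chain R V n)
  | 0 => tailTheta R V G a 0
  | n + 1 => tailTheta R V G a (n + 1) ⊓ LinearMap.ker (tailBoundary R V n)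

def tailBoundaries (G : SDigraph V) (a : V) (n : ℕ) : Submodule R (Chain R V n) :=
  (tailTheta R V G a (n + 1)).map (tailBoundary R V n)

/-- Primitive `a`-tail homology `H_n^{[a,·]}(G)`. -/
abbrev tailHomology (G : SDigraph V) (a : V) (n : ℕ) : Type _ :=
  ↥((tailCycles R V G a n).map (tailBoundaries R V G a n).mkQ)

/-- The path-reversal map with sign `(-1)^{n(n+1)/2}`. -/
def revMap (n : ℕ) : Chain R V n →ₗ[R] Chain R V n :=
  Finsupp.lsum R fun p =>
    ((-1 : R) ^ (n * (n + 1) / 2)) • Finsupp.lsingle (fun i : Fin (n + 1) => p i.rev)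

end

/-- The inverse directed digraph: all arrows reversed. -/
def SDigraph.reverse {V : Type} (G : SDigraph V) : SDigraph V where
  Adj v w := G.Adj w v
  loopless v h := G.loopless v h

section

variable (R : Type) [CommRing R] (V W : Type) [DecidableEq V] [DecidableEq W]

/-- The chain map `f_♯` induced by a vertex map: elementary paths go to their image
when regular, and to `0` otherwise. -/
def chainMap (f : V → W) (n : ℕ) : Chain R V n →ₗ[R] Chain R W n :=
  Finsupp.lsum R fun p =>
    if IsRegular (fun i => f (p i)) then Finsupp.lsingle (fun i => f (p i)) else 0

end

/-- A digraph is asymmetric if it has no symmetric pair of arrows. -/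
def SDigraph.Asymmetric {V : Type} (G : SDigraph V) : Prop :=
  ∀ v w, G.Adj v w → ¬ G.Adj w v


theorem mem_pathsWith_iff {R V : Type} [CommRing R] [DecidableEq V] {n : ℕ}
    (P : (Fin (n + 1) → V) → Prop) (w : Chain R V n) :
    w ∈ pathsWith R V P ↔ ∀ p, w p ≠ 0 → P p := by
  constructor
  · intro h p hp
    exact h p (Finsupp.mem_support_iff.2 hp)
  · intro h p hp
    exact h p (Finsupp.mem_support_iff.1 hp)

theorem regProj_apply {R V : Type} [CommRing R] [DecidableEq V] {n : ℕ}
    (w : Chain R V n) (q : Fin (n + 1) → V) :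
    regProj R V n w q = if IsRegular q then w q else 0 := by
  classical
  induction w using Finsupp.induction_linear with
  | zero => simp
  | add f g hf hg =>
    rw [map_add, Finsupp.add_apply, hf, hg]
    split_ifs <;> simp
  | single p c =>
    simp only [regProj, Finsupp.lsum_single]
    by_cases hpq : p = q
    · subst hpq
      by_cases h : IsRegular p <;> simp [h]
    · by_cases h : IsRegular p <;> simp [h, hpq]

/-- A non-allowed face of an allowed path is an interior one: it has the same ends. -/
theorem face_ends {V : Type} (G : SDigraph V) {n : ℕ}
    (p : Fin (n + 2) → V) (hp : IsAllowed G p) (m : Fin (n + 2))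
    (hq : ¬ IsAllowed G (fun i : Fin (n + 1) => p (m.succAbove i))) :
    p 0 = p (m.succAbove 0) ∧ p (Fin.last (n + 1)) = p (m.succAbove (Fin.last n)) := by
  have h0 : m ≠ 0 := by
    rintro rfl
    apply hq
    intro i
    simpa using hp i.succ
  have hl : m ≠ Fin.last (n + 1) := by
    rintro rfl
    apply hq
    intro i
    simpa using hp i.castSucc
  rw [Fin.succAbove_ne_zero_zero h0, Fin.succAbove_ne_last_last hl]
  exact ⟨rfl, rfl⟩

theorem boundary_apply_eq_zero {R V : Type} [CommRing R] [DecidableEq V]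
    (G : SDigraph V) {n : ℕ} (w : Chain R V (n + 1)) (q : Fin (n + 1) → V)
    (hq : ¬ IsAllowed G q)
    (hw : ∀ p, w p ≠ 0 → IsAllowed G p ∧
      ¬ (p 0 = q 0 ∧ p (Fin.last (n + 1)) = q (Fin.last n))) :
    boundary R V n w q = 0 := by
  classical
  simp only [boundary, Finsupp.lsum_apply, Finsupp.sum, Finsupp.finsetSum_apply,
    LinearMap.sum_apply, LinearMap.smul_apply, Finsupp.smul_apply, Finsupp.lsingle_apply]
  refine Finset.sum_eq_zero fun p hp => Finset.sum_eq_zero fun m _ => ?_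
  obtain ⟨ha, hne⟩ := hw p (Finsupp.mem_support_iff.1 hp)
  rw [Finsupp.single_apply, if_neg, smul_zero]
  rintro rfl
  exact hne (face_ends G p ha m hq)

theorem filter_mem_omega {R V : Type} [CommRing R] [DecidableEq V]
    (G : SDigraph V) (n : ℕ) (a b : V) (w : Chain R V n) (hw : w ∈ omegaChains R V G n) :
    w.filter (fun p => p 0 = a ∧ p (Fin.last n) = b) ∈ omegaChains R V G n := by
  classical
  have hA : ∀ {k : ℕ} (P : (Fin (k + 1) → V) → Prop) [DecidablePred P] (u : Chain R V k),
      u ∈ allowedChains R V G k → u.filter P ∈ allowedChains R V G k := by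
    intro k P _ u hu p hp
    rw [Finsupp.support_filter, Finset.mem_filter] at hp
    exact hu p hp.1
  cases n with
  | zero => exact hA _ _ hw
  | succ n =>
    obtain ⟨hw1, hw2⟩ := hw
    refine ⟨hA _ _ hw1, ?_⟩
    have hw2' := (mem_pathsWith_iff _ _).1 (Submodule.mem_comap.1 hw2)
    have hw1' := (mem_pathsWith_iff _ _).1 hw1
    refine Submodule.mem_comap.2 ((mem_pathsWith_iff _ _).2 ?_)
    intro q hne
    by_contra hq
    apply hne
    have h2 : (regProj R V n ∘ₗ boundary R V n) w q = 0 := by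
      by_contra h
      exact hq (hw2' q h)
    rw [LinearMap.comp_apply, regProj_apply] at h2 ⊢
    split_ifs at h2 ⊢ with hr
    · by_cases hab : q 0 = a ∧ q (Fin.last n) = b
      · have hs := Finsupp.filter_add_filter_not w
          (fun p => p 0 = a ∧ p (Fin.last (n + 1)) = b)
        rw [← hs, map_add, Finsupp.add_apply] at h2
        rw [boundary_apply_eq_zero G (w.filter fun p =>
          ¬ (p 0 = a ∧ p (Fin.last (n + 1)) = b)) q hq, add_zero] at h2
        · exact h2
        · intro p hp
          rw [Finsupp.filter_apply] at hp
          split_ifs at hp with h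
          · exact absurd rfl hp
          · refine ⟨hw1' p hp, ?_⟩
            rw [hab.1, hab.2]
            exact h
      · apply boundary_apply_eq_zero G _ q hq
        intro p hp
        rw [Finsupp.filter_apply] at hp
        split_ifs at hp with h
        · refine ⟨hw1' p hp, ?_⟩
          rw [h.1, h.2]
          exact fun hh => hab ⟨hh.1.symm, hh.2.symm⟩
        · exact absurd rfl hp
    · rfl

/-- Corollary 2.4: `Ω_n(G)` is the internal direct sum of its
submodules `Ω_n^{[a,b]}(G)` of `(a,b)`-cluster paths, over all pairs `(a,b)` of vertices. -/
theorem omega_direct_sum_clusters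
    (R : Type) [CommRing R] (V : Type) [DecidableEq V] [Fintype V]
    (G : SDigraph V) (n : ℕ) :
    DirectSum.IsInternal fun ab : V × V =>
      (clusterSet R V ab.1 ab.2 n ⊓ omegaChains R V G n).comap
        (omegaChains R V G n).subtype := by
  
  have key := @DirectSum.isInternal_submodule_of_iSupIndep_of_iSup_eq_top R _ (V × V) _
    (omegaChains R V G n) _ _ (fun ab : V × V =>
      (clusterSet R V ab.1 ab.2 n ⊓ omegaChains R V G n).comap
        (omegaChains R V G n).subtype)
  refine key ?_ ?_
  · intro ab
    rw [Submodule.disjoint_def]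
    intro x hx hx'
    have hle : (⨆ (j : V × V) (_ : j ≠ ab),
        (clusterSet R V j.1 j.2 n ⊓ omegaChains R V G n).comap (omegaChains R V G n).subtype) ≤
        (pathsWith R V (fun p => (p 0, p (Fin.last n)) ≠ ab)).comap
          (omegaChains R V G n).subtype := by
      refine iSup₂_le fun j hj y hy => ?_
      intro p hp
      have := hy.1 p hp
      rw [this.1, this.2]
      exact hj
    have h1 := (mem_pathsWith_iff _ _).1 (Submodule.mem_comap.1 (hle hx'))
    have h2 := (mem_pathsWith_iff _ _).1 hx.1
    apply Subtype.ext
    ext p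
    by_contra h
    exact h1 p h (Prod.ext (h2 p h).1 (h2 p h).2)
  · rw [eq_top_iff]
    rintro x -
    have hx : x = ∑ ab : V × V, (⟨x.1.filter (fun p => p 0 = ab.1 ∧ p (Fin.last n) = ab.2),
        filter_mem_omega G n ab.1 ab.2 x.1 x.2⟩ : omegaChains R V G n) := by
      apply Subtype.ext
      ext p
      rw [AddSubmonoidClass.coe_finsetSum, Finsupp.finsetSum_apply,
        Finset.sum_eq_single (p 0, p (Fin.last n))]
      · simp [Finsupp.filter_apply]
      · intro ab _ hne
        rw [Finsupp.filter_apply, if_neg]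
        exact fun h => hne (Prod.ext h.1.symm h.2.symm)
      · simp
    rw [hx]
    refine Submodule.sum_mem _ fun ab _ => Submodule.mem_iSup_of_mem ab ?_
    refine Submodule.mem_comap.2 ⟨?_, filter_mem_omega G n ab.1 ab.2 x.1 x.2⟩
    intro p hp
    rw [Submodule.subtype_apply, Finsupp.support_filter, Finset.mem_filter] at hp
    exact hp.2


end PrimitivePath

end
end

section
/- Let f: G → H be a digraph map where H is asymmetric (H has no symmetric pairs of arrows). Then for all n ≥ 0, the induced map f_♯: Λ_n(V_G) → Λ_n(V_H) (sending an elementary path to its image if the image is regular and to 0 otherwise) restricted to A_n(G) commutes with the differentials: ∂ f_♯ = f_♯ ∂ as maps A_n(G) → Λ_{n-1}(V_H). -/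
noncomputable section

namespace PrimitivePath

theorem face_eq {W : Type} {n : ℕ} (q : Fin (n + 2) → W) (j : Fin (n + 1))
    (hj : q j.castSucc = q j.succ) :
    (fun i : Fin (n + 1) => q (j.castSucc.succAbove i)) =
      fun i : Fin (n + 1) => q (j.succ.succAbove i) := by
  funext i
  rcases lt_trichotomy i j with h | h | h
  · rw [Fin.succAbove_of_castSucc_lt _ _ (by simpa using h),
      Fin.succAbove_of_castSucc_lt _ _ (by
        rw [Fin.lt_def] at *; simp; omega)]
  · subst h
    rw [Fin.succAbove_of_le_castSucc _ _ le_rfl,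
      Fin.succAbove_of_castSucc_lt _ _ (by rw [Fin.lt_def]; simp)]
    exact hj.symm
  · rw [Fin.succAbove_of_le_castSucc _ _ (by
        rw [Fin.lt_def] at h; rw [Fin.le_def]; simp; omega),
      Fin.succAbove_of_le_castSucc _ _ (by
        rw [Fin.lt_def] at h; rw [Fin.le_def]; simp; omega)]

theorem face_irregular {W : Type} {n : ℕ} (q : Fin (n + 2) → W) (j : Fin (n + 1))
    (hj : q j.castSucc = q j.succ) (m : Fin (n + 2)) (h1 : m ≠ j.castSucc) (h2 : m ≠ j.succ) :
    ¬ IsRegular (fun i : Fin (n + 1) => q (m.succAbove i)) := by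
  intro hreg
  have h1' : (m : ℕ) ≠ j := fun h => h1 (Fin.ext (by simpa using h))
  have h2' : (m : ℕ) ≠ j + 1 := fun h => h2 (Fin.ext (by simpa using h))
  have hm := m.isLt
  have hjl := j.isLt
  by_cases hlt : (m : ℕ) < j
  · have := hreg ⟨j - 1, by omega⟩
    apply this
    show q _ = q _
    rw [Fin.succAbove_of_le_castSucc _ _ (by rw [Fin.le_def]; simp; omega),
      Fin.succAbove_of_le_castSucc _ _ (by rw [Fin.le_def]; simp; omega)]
    convert hj using 2 <;> apply Fin.ext <;> simp <;> omega
  · have := hreg ⟨j, by omega⟩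
    apply this
    show q _ = q _
    rw [Fin.succAbove_of_castSucc_lt _ _ (by rw [Fin.lt_def]; simp; omega),
      Fin.succAbove_of_castSucc_lt _ _ (by rw [Fin.lt_def]; simp; omega)]
    exact hj

theorem face_regular {W : Type} (H : SDigraph W) (hH : H.Asymmetric) {n : ℕ}
    (q : Fin (n + 2) → W) (hq : ∀ i : Fin (n + 1), H.Adj (q i.castSucc) (q i.succ))
    (m : Fin (n + 2)) :
    IsRegular (fun i : Fin (n + 1) => q (m.succAbove i)) := by
  have hne : ∀ i : Fin (n + 1), q i.castSucc ≠ q i.succ := fun i h =>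
    H.loopless (q i.succ) (by have := hq i; rwa [h] at this)
  intro i
  show q _ ≠ q _
  have hm := m.isLt
  have hil := i.isLt
  rcases lt_trichotomy (m : ℕ) (i + 1) with h | h | h
  · rw [Fin.succAbove_of_le_castSucc _ _ (by rw [Fin.le_def]; simp; omega),
      Fin.succAbove_of_le_castSucc _ _ (by rw [Fin.le_def]; simp; omega)]
    exact hne i.succ
  · rw [Fin.succAbove_of_castSucc_lt _ _ (by rw [Fin.lt_def]; simp; omega),
      Fin.succAbove_of_le_castSucc _ _ (by rw [Fin.le_def]; simp; omega)]
    intro he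
    have a1 := hq i.castSucc
    have a2 := hq i.succ
    rw [he] at a1
    exact hH _ _ a1 a2
  · rw [Fin.succAbove_of_castSucc_lt _ _ (by rw [Fin.lt_def]; simp; omega),
      Fin.succAbove_of_castSucc_lt _ _ (by rw [Fin.lt_def]; simp; omega)]
    exact hne i.castSucc

theorem chainMap_single (R : Type) [CommRing R] (V W : Type) [DecidableEq V] [DecidableEq W]
    (f : V → W) (n : ℕ) (p : Fin (n + 1) → V) (c : R) :
    chainMap R V W f n (Finsupp.single p c) =
      if IsRegular (fun i => f (p i)) then Finsupp.single (fun i => f (p i)) c else 0 := by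
  unfold chainMap
  rw [Finsupp.lsum_single]
  split_ifs <;> rfl

theorem boundary_single (R V : Type) [CommRing R] [DecidableEq V]
    (n : ℕ) (p : Fin (n + 2) → V) (c : R) :
    boundary R V n (Finsupp.single p c) =
      ∑ m : Fin (n + 2), ((-1 : R) ^ (m : ℕ)) •
        Finsupp.single (fun i : Fin (n + 1) => p (m.succAbove i)) c := by
  unfold boundary
  rw [Finsupp.lsum_single]
  simp only [LinearMap.sum_apply, LinearMap.smul_apply, Finsupp.lsingle_apply]

theorem comm_single (R : Type) [CommRing R] (V W : Type) [DecidableEq V] [DecidableEq W]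
    (G : SDigraph V) (H : SDigraph W) (f : V → W)
    (hf : ∀ v w, G.Adj v w → f v = f w ∨ H.Adj (f v) (f w))
    (hH : H.Asymmetric) (n : ℕ) (p : Fin (n + 2) → V) (hp : IsAllowed G p) (c : R) :
    boundary R W n (chainMap R V W f (n + 1) (Finsupp.single p c)) =
      chainMap R V W f n (boundary R V n (Finsupp.single p c)) := by
  rw [chainMap_single, boundary_single, map_sum]
  simp only [map_smul, chainMap_single]
  by_cases hreg : IsRegular (fun i => f (p i))
  · rw [if_pos hreg, boundary_single]
    refine Finset.sum_congr rfl fun m _ => ?_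
    rw [if_pos (face_regular H hH (fun i => f (p i))
      (fun i => (hf _ _ (hp i)).resolve_left (hreg i)) m)]
  · rw [if_neg hreg, map_zero]
    have : ∃ j : Fin (n + 1), f (p j.castSucc) = f (p j.succ) := by
      by_contra hcon
      exact hreg fun i h => hcon ⟨i, h⟩
    obtain ⟨j, hj⟩ := this
    symm
    rw [Fintype.sum_eq_add j.castSucc j.succ (by simp [Fin.ext_iff])]
    · have hfe := face_eq (fun i => f (p i)) j hj
      rw [hfe]
      rw [Fin.val_castSucc, Fin.val_succ, pow_succ, ← add_smul, mul_neg_one, add_neg_cancel,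
        zero_smul]
    · rintro m ⟨h1, h2⟩
      rw [if_neg (face_irregular (fun i => f (p i)) j hj m h1 h2), smul_zero]

/-- Lemma 3.3: if `f : G → H` is a digraph map and `H` is asymmetric,
then `f_♯` commutes with the differential on allowed chains. -/
theorem chainMap_comm_boundary_of_asymmetric
    (R : Type) [CommRing R] (V W : Type) [DecidableEq V] [DecidableEq W]
    [Fintype V] [Fintype W]
    (G : SDigraph V) (H : SDigraph W) (f : V → W)
    (hf : ∀ v w, G.Adj v w → f v = f w ∨ H.Adj (f v) (f w))
    (hH : H.Asymmetric) (n : ℕ) (x : Chain R V (n + 1))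
    (hx : x ∈ allowedChains R V G (n + 1)) :
    boundary R W n (chainMap R V W f (n + 1) x) =
      chainMap R V W f n (boundary R V n x) := by
  rw [← Finsupp.sum_single x, Finsupp.sum]
  simp only [map_sum]
  exact Finset.sum_congr rfl fun p hp =>
    comm_single R V W G H f hf hH n p (hx p hp) (x p)

end PrimitivePath

end
end
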